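/- arXiv:1708.09378 — 2 statements merged into one kernel-verified Lean document; each statement's English description precedes it below -/
import Mathlib

section
/- Fix integers r ≥ 0, g ≥ 1 and nonincreasing (r+1)-tuples λ^1, ρ^g of integers, and let σ be the set of boxes of ρ^g not contained in λ^1. Let t be any assignment of finite subsets of {1,…,g} to the boxes of ℤ × {0,…,r}, and let N be the number of distinct symbols occurring in t. Then Σ_{P ∈ PT(λ^1,ρ^g), tab(P) = t} μ(P) equals (−1)^{N−|σ|} if t is an almost-standard set-valued tableau on σ — that is, t(b) ≠ ∅ exactly for b ∈ σ, every symbol n ∈ {1,…,g} occurs in at most one box of t, and for every box (x,y) all elements of t(x,y) are strictly less than all elements of t(x+1,y) and all elements of t(x,y+1) — and equals 0 otherwise. -/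
namespace Pont

/-- The set of boxes of a nonincreasing `(r+1)`-tuple `l`: all `(x,y)` with `x < l y`. -/
def boxes (r : ℕ) (l : Fin (r + 1) → ℤ) : Set (ℤ × Fin (r + 1)) := {b | b.1 < l b.2}

/-- `b` is an inward corner of `l`: a minimal box not in `l` for the componentwise order. -/
def IsInwardCorner (r : ℕ) (l : Fin (r + 1) → ℤ) (b : ℤ × Fin (r + 1)) : Prop :=
  b ∉ boxes r l ∧ ∀ b' : ℤ × Fin (r + 1), b' ∉ boxes r l → b'.1 ≤ b.1 → b'.2 ≤ b.2 → b' = b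

/-- `l ∪ b`: the tuple obtained by increasing `l` by `1` in the row of `b`. -/
def addBox (r : ℕ) (l : Fin (r + 1) → ℤ) (b : ℤ × Fin (r + 1)) : Fin (r + 1) → ℤ :=
  fun y => if y = b.2 then l y + 1 else l y

/-- Raw data of a pontableau sequence `(λ¹, ρ¹, …, λᵍ, ρᵍ)`; `lam n`, `rho n` are only
meaningful for `1 ≤ n ≤ g`, and are normalised to `0` elsewhere. -/
structure PontSeq (r : ℕ) where
  lam : ℕ → Fin (r + 1) → ℤ
  rho : ℕ → Fin (r + 1) → ℤ

/-- The conditions defining a pontableau sequence. -/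
def ValidPont (r g : ℕ) (P : PontSeq r) : Prop :=
  (∀ n, 1 ≤ n → n ≤ g → Antitone (P.lam n) ∧ Antitone (P.rho n)) ∧
  (∀ n, 1 ≤ n → n + 1 ≤ g → boxes r (P.lam (n + 1)) ⊆ boxes r (P.rho n)) ∧
  (∀ n, 1 ≤ n → n ≤ g →
    boxes r (P.rho n) ⊆ boxes r (P.lam n) ∨
      ∃ b, IsInwardCorner r (P.lam n) b ∧
        boxes r (P.rho n) ⊆ boxes r (addBox r (P.lam n) b)) ∧
  (∀ n, n = 0 ∨ g < n → P.lam n = 0 ∧ P.rho n = 0)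

/-- `PT(λ¹, ρᵍ)`: pontableaux with prescribed first tuple `λ¹` and last tuple `ρᵍ`. -/
def PT (r g : ℕ) (l1 rg : Fin (r + 1) → ℤ) : Set (PontSeq r) :=
  {P | ValidPont r g P ∧ P.lam 1 = l1 ∧ P.rho g = rg}

/-- The boxes carrying the left-removal `−n`, namely `ρ^{n−1} ∖ λ^n`. -/
def lrs (r : ℕ) (P : PontSeq r) (n : ℕ) : Set (ℤ × Fin (r + 1)) :=
  boxes r (P.rho (n - 1)) \ boxes r (P.lam n)

open Classical in
/-- `μ(P)`: zero if some left-removal `−n` occurs in two (horizontally or vertically)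
adjacent boxes, and otherwise `(−1)^L` where `L` is the total number of left-removals. -/
noncomputable def mu (r g : ℕ) (P : PontSeq r) : ℤ :=
  if ∃ n, 2 ≤ n ∧ n ≤ g ∧ ∃ b ∈ lrs r P n,
      ((b.1 + 1, b.2) ∈ lrs r P n ∨
        ∃ y' : Fin (r + 1), (y' : ℕ) = (b.2 : ℕ) + 1 ∧ (b.1, y') ∈ lrs r P n)
  then 0
  else (-1) ^ ∑ n ∈ Finset.Icc 2 g, (lrs r P n).ncard

open Classical in
/-- `χ(P)`: `1` if every augmentation `n ∈ {1,…,g}` occurs in some box (i.e. each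
`ρ^n ∖ λ^n` is nonempty), and `0` otherwise. -/
noncomputable def chi (r g : ℕ) (P : PontSeq r) : ℤ :=
  if ∀ n, 1 ≤ n → n ≤ g → (boxes r (P.rho n) \ boxes r (P.lam n)).Nonempty then 1 else 0


end Pont

namespace Pont

open Finset

theorem boxes_subset_iff {r : ℕ} {a b : Fin (r + 1) → ℤ} : boxes r a ⊆ boxes r b ↔ a ≤ b := by
  constructor
  · intro h y
    by_contra! hy
    have := h (show (b y, y) ∈ boxes r a from hy)
    simp [boxes] at this
  · intro h p hp
    exact lt_of_lt_of_le hp (h p.2)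

/-- The tuple obtained by decreasing `l` by `1` in row `y`. -/
def dec {r : ℕ} (l : Fin (r + 1) → ℤ) (y : Fin (r + 1)) : Fin (r + 1) → ℤ :=
  fun z => if z = y then l z - 1 else l z

/-- The last box of row `y` of `l` can be removed. -/
def RemRow {r : ℕ} (l : Fin (r + 1) → ℤ) (y : Fin (r + 1)) : Prop :=
  ∀ z, y < z → l z < l y

theorem dec_le {r : ℕ} (l : Fin (r + 1) → ℤ) (y : Fin (r + 1)) : dec l y ≤ l := by
  intro z
  simp only [dec]
  split_ifs <;> omega

theorem antitone_dec {r : ℕ} {l : Fin (r + 1) → ℤ} (hl : Antitone l) {y : Fin (r + 1)}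
    (hy : RemRow l y) : Antitone (dec l y) := by
  intro a b hab
  have h1 := hl hab
  simp only [dec]
  split_ifs with h2 h3 h3
  · omega
  · omega
  · subst h3
    have := hy b (lt_of_le_of_ne hab (Ne.symm h2))
    omega
  · exact h1

theorem mem_boxes_dec {r : ℕ} {l : Fin (r + 1) → ℤ} {y : Fin (r + 1)}
    {b : ℤ × Fin (r + 1)} : b ∈ boxes r (dec l y) ↔ b ∈ boxes r l ∧ b ≠ (l y - 1, y) := by
  obtain ⟨x, z⟩ := b
  simp only [boxes, dec, Set.mem_ofPred_eq, ne_eq, Prod.mk.injEq]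
  by_cases h : z = y
  · subst h
    simp
    omega
  · simp [h]

theorem step_iff {r : ℕ} {l p : Fin (r + 1) → ℤ} (hp : Antitone p) :
    (boxes r p ⊆ boxes r l ∨ ∃ b, IsInwardCorner r l b ∧ boxes r p ⊆ boxes r (addBox r l b)) ↔
      (boxes r p \ boxes r l).Subsingleton := by
  constructor
  · rintro (h | ⟨b, hb, h⟩)
    · rw [Set.sdiff_eq_empty.2 h]
      exact Set.subsingleton_empty
    · have key : ∀ q ∈ boxes r p \ boxes r l, q = (l b.2, b.2) := by
        rintro ⟨x, y⟩ ⟨h1, h2⟩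
        have h3 := h h1
        simp only [boxes, addBox, Set.mem_ofPred_eq] at h2 h3
        split_ifs at h3 with h4
        · subst h4
          ext <;> simp
          omega
        · omega
      intro q hq q' hq'
      rw [key q hq, key q' hq']
  · intro h
    by_cases he : boxes r p ⊆ boxes r l
    · exact Or.inl he
    · right
      obtain ⟨b, hb, hbl⟩ := Set.not_subset.1 he
      refine ⟨b, ⟨hbl, ?_⟩, ?_⟩
      · intro b' hb' h1 h2
        refine h ⟨?_, hb'⟩ ⟨hb, hbl⟩
        have := hp h2
        simp only [boxes, Set.mem_ofPred_eq] at hb ⊢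
        omega
      · intro q hq
        by_cases hql : q ∈ boxes r l
        · simp only [boxes, addBox, Set.mem_ofPred_eq] at hql ⊢
          split_ifs <;> omega
        · have hqb := h ⟨hq, hql⟩ ⟨hb, hbl⟩
          subst hqb
          have h5 : (l q.2, q.2) = q := by
            refine h ⟨?_, ?_⟩ ⟨hb, hbl⟩
            · simp only [boxes, Set.mem_ofPred_eq] at hb hbl ⊢
              omega
            · simp [boxes]
          have h6 : l q.2 = q.1 := congrArg Prod.fst h5
          simp only [boxes, addBox, Set.mem_ofPred_eq]
          simp
          omega

/-- Two boxes of `s` are horizontally or vertically adjacent. -/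
def HasAdj {r : ℕ} (s : Set (ℤ × Fin (r + 1))) : Prop :=
  ∃ b ∈ s, (b.1 + 1, b.2) ∈ s ∨ ∃ y' : Fin (r + 1), (y' : ℕ) = (b.2 : ℕ) + 1 ∧ (b.1, y') ∈ s

open Classical in
/-- The signed weight of a single left-removal set. -/
noncomputable def weight {r : ℕ} (s : Set (ℤ × Fin (r + 1))) : ℤ :=
  if HasAdj s then 0 else (-1) ^ s.ncard

theorem mu_eq_prod (r g : ℕ) (P : PontSeq r) :
    mu r g P = ∏ n ∈ Icc 2 g, weight (lrs r P n) := by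
  unfold mu
  split_ifs with h
  · obtain ⟨n, h1, h2, h3⟩ := h
    symm
    apply Finset.prod_eq_zero (Finset.mem_Icc.2 ⟨h1, h2⟩)
    exact if_pos h3
  · rw [← Finset.prod_pow_eq_pow_sum]
    refine Finset.prod_congr rfl fun n hn => ?_
    rw [Finset.mem_Icc] at hn
    exact (if_neg fun h3 => h ⟨n, hn.1, hn.2, h3⟩).symm

open Classical in
/-- The tuple obtained by decreasing `l` by `1` in all rows of `C`. -/
noncomputable def decSet {r : ℕ} (l : Fin (r + 1) → ℤ) (C : Finset (Fin (r + 1))) :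
    Fin (r + 1) → ℤ :=
  fun z => if z ∈ C then l z - 1 else l z

theorem diff_decSet {r : ℕ} (l : Fin (r + 1) → ℤ) (C : Finset (Fin (r + 1))) :
    boxes r l \ boxes r (decSet l C) = Set.image (fun y => (l y - 1, y)) (C : Set (Fin (r + 1))) := by
  ext ⟨x, y⟩
  simp only [boxes, decSet, Set.mem_sdiff, Set.mem_ofPred_eq, Set.mem_image, Finset.mem_coe,
    Prod.mk.injEq]
  constructor
  · rintro ⟨h1, h2⟩
    split_ifs at h2 with h
    · exact ⟨y, h, by omega, rfl⟩
    · omega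
  · rintro ⟨z, hz, h1, rfl⟩
    simp [hz]
    omega

theorem antitone_decSet {r : ℕ} {l : Fin (r + 1) → ℤ} (hl : Antitone l)
    {C : Finset (Fin (r + 1))} (hC : ∀ y ∈ C, RemRow l y) : Antitone (decSet l C) := by
  intro a b hab
  have h1 := hl hab
  rcases eq_or_lt_of_le hab with rfl | hlt
  · exact le_rfl
  simp only [decSet]
  split_ifs with h2 h3 h3
  · omega
  · omega
  · have := hC a h3 b hlt
    omega
  · exact h1

theorem weight_decSet {r : ℕ} {l : Fin (r + 1) → ℤ}
    {C : Finset (Fin (r + 1))} (hC : ∀ y ∈ C, RemRow l y) :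
    weight (boxes r l \ boxes r (decSet l C)) = (-1) ^ #C := by
  rw [diff_decSet, weight, if_neg, Set.ncard_image_of_injective, Set.ncard_coe_finset]
  · intro a b hab
    exact congrArg Prod.snd hab
  · rintro ⟨_, ⟨y, hy, rfl⟩, ⟨z, hz, h⟩ | ⟨y', hy', z, hz, h⟩⟩
    · simp only [Prod.mk.injEq] at h
      obtain ⟨h1, rfl⟩ := h
      omega
    · simp only [Prod.mk.injEq] at h
      obtain ⟨h1, rfl⟩ := h
      have := hC y hy z (by rw [Fin.lt_def]; simp only at hy'; omega)
      omega

theorem eq_decSet_of_not_hasAdj {r : ℕ} {l m : Fin (r + 1) → ℤ} (hl : Antitone l)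
    (hm : Antitone m) (hml : m ≤ l) (h : ¬ HasAdj (boxes r l \ boxes r m)) :
    m = decSet l {y | m y < l y} ∧ ∀ y, m y < l y → RemRow l y := by
  have h1 : ∀ y, l y - 1 ≤ m y := by
    intro y
    by_contra! hy
    refine h ⟨(m y, y), ⟨?_, ?_⟩, Or.inl ⟨?_, ?_⟩⟩ <;> simp only [boxes, Set.mem_ofPred_eq] <;> omega
  constructor
  · funext y
    have := h1 y
    have : m y ≤ l y := hml y
    simp only [decSet, Finset.mem_filter, Finset.mem_univ, true_and]
    split_ifs <;> omega
  · intro y hy z hz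
    by_contra! hc
    have hlt : (y : ℕ) + 1 < r + 1 := by
      have := z.2
      rw [Fin.lt_def] at hz
      omega
    let y' : Fin (r + 1) := ⟨y + 1, hlt⟩
    have hy1 : l y ≤ l y' := hc.trans (hl (show y' ≤ z by rw [Fin.le_def]; exact hz))
    have hyy' : y ≤ y' := by rw [Fin.le_def]; simp [y']
    have hy2 := hm hyy'
    refine h ⟨(m y, y), ⟨?_, ?_⟩, Or.inr ⟨y', rfl, ?_, ?_⟩⟩ <;>
      simp only [boxes, Set.mem_ofPred_eq] <;> omega

open Classical in
/-- Möbius inversion in the lattice of nonincreasing tuples. -/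
theorem sum_weight {r : ℕ} {l n : Fin (r + 1) → ℤ} (hl : Antitone l) (hn : Antitone n) :
    ∑ m ∈ Icc n l with Antitone m, weight (boxes r l \ boxes r m) = if n = l then 1 else 0 := by
  by_cases hnl : n ≤ l
  swap
  · rw [Finset.Icc_eq_empty hnl, if_neg (by rintro rfl; exact hnl le_rfl)]
    simp
  let R : Finset (Fin (r + 1)) := {y | n y < l y ∧ RemRow l y}
  have hR : ∀ C ∈ R.powerset, ∀ y ∈ C, n y < l y ∧ RemRow l y := by
    intro C hC y hy
    simpa [R] using Finset.mem_powerset.1 hC hy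
  have key : ∑ C ∈ R.powerset, (-1 : ℤ) ^ #C =
      ∑ m ∈ Icc n l with Antitone m, weight (boxes r l \ boxes r m) := by
    refine Finset.sum_of_injOn (decSet l) ?_ ?_ ?_ ?_
    · intro C hC D hD hCD
      ext y
      have := congrFun hCD y
      simp only [decSet] at this
      split_ifs at this with h1 h2 h2 <;> first | omega | simp_all
    · intro C hC
      simp only [Finset.coe_filter, Finset.mem_Icc, Set.mem_ofPred_eq]
      refine ⟨⟨?_, ?_⟩, antitone_decSet hl fun y hy => (hR C hC y hy).2⟩
      · intro y
        have := hnl y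
        simp only [decSet]
        split_ifs with h
        · have := (hR C hC y h).1
          omega
        · exact this
      · intro y
        simp only [decSet]
        split_ifs <;> omega
    · intro m hm hm'
      rw [Finset.mem_filter, Finset.mem_Icc] at hm
      rw [weight, if_pos]
      by_contra hadj
      obtain ⟨h1, h2⟩ := eq_decSet_of_not_hasAdj hl hm.2 hm.1.2 hadj
      refine hm' ⟨_, ?_, h1.symm⟩
      rw [Finset.mem_coe, Finset.mem_powerset]
      intro y hy
      simp only [Finset.mem_filter, Finset.mem_univ, true_and, R] at hy ⊢
      exact ⟨lt_of_le_of_lt (hm.1.1 y) hy, h2 y hy⟩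
    · intro C hC
      exact (weight_decSet fun y hy => (hR C hC y hy).2).symm
  rw [← key, Finset.sum_powerset_neg_one_pow_card]
  refine if_congr ?_ rfl rfl
  constructor
  · intro hRe
    by_contra hne
    have hex : (univ.filter fun y => n y < l y).Nonempty := by
      by_contra hemp
      rw [Finset.not_nonempty_iff_eq_empty, Finset.filter_eq_empty_iff] at hemp
      exact hne (le_antisymm hnl fun y => not_lt.1 (hemp (Finset.mem_univ y)))
    obtain ⟨y, hy, hmax⟩ := Finset.exists_maximal hex
    have : y ∈ R := by
      simp only [Finset.mem_filter, Finset.mem_univ, true_and, R] at hy hmax ⊢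
      refine ⟨hy, fun z hz => ?_⟩
      by_contra! hc
      have := hn hz.le
      exact absurd (hmax (by omega) hz.le) (not_le.2 hz)
    simp [hRe] at this
  · rintro rfl
    simp [R]

theorem diff_eq_singleton_iff {r : ℕ} {m p : Fin (r + 1) → ℤ} (hm : Antitone m)
    (x : ℤ) (y : Fin (r + 1)) :
    boxes r p \ boxes r m = {(x, y)} ↔
      (x = p y - 1 ∧ RemRow p y) ∧ dec p y ≤ m ∧ ¬ p ≤ m := by
  constructor
  · intro h
    have hmem : ∀ b, b ∈ boxes r p → b ∉ boxes r m → b = (x, y) := by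
      intro b h1 h2
      have : b ∈ boxes r p \ boxes r m := ⟨h1, h2⟩
      rwa [h] at this
    have hb : (x, y) ∈ boxes r p \ boxes r m := by rw [h]; rfl
    simp only [boxes, Set.mem_sdiff, Set.mem_ofPred_eq] at hb
    have hx : x = p y - 1 := by
      have := hmem (p y - 1, y) (by simp [boxes]) (by simp only [boxes, Set.mem_ofPred_eq]; omega)
      simpa using (congrArg Prod.fst this).symm
    refine ⟨⟨hx, ?_⟩, ?_, ?_⟩
    · intro z hz
      by_contra! hc
      have h2 := hm hz.le
      have := hmem (x, z) (by simp only [boxes, Set.mem_ofPred_eq]; omega)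
        (by simp only [boxes, Set.mem_ofPred_eq]; omega)
      exact hz.ne' (congrArg Prod.snd this)
    · rw [← boxes_subset_iff]
      intro b hb'
      rw [mem_boxes_dec] at hb'
      by_contra hbm
      exact hb'.2 (hx ▸ hmem b hb'.1 hbm)
    · intro hle
      have : p y ≤ m y := hle y
      omega
  · rintro ⟨⟨rfl, hrem⟩, h1, h2⟩
    rw [← boxes_subset_iff] at h1
    have hsub : boxes r p \ boxes r m ⊆ {(p y - 1, y)} := by
      intro b hb
      by_contra hne
      exact hb.2 (h1 (mem_boxes_dec.2 ⟨hb.1, hne⟩))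
    rcases Set.subset_singleton_iff_eq.1 hsub with h | h
    · exact absurd (boxes_subset_iff.1 (Set.sdiff_eq_empty.1 h)) h2
    · exact h

open Classical in
/-- The total weight of passing from `q = ρ^{n-1}` to `p = ρ^n` when the augmentation `n`
occupies exactly the boxes of `S`. -/
noncomputable def kernel {r : ℕ} (S : Set (ℤ × Fin (r + 1))) (q p : Fin (r + 1) → ℤ) : ℤ :=
  ∑ m ∈ Icc (p - 1) q with Antitone m ∧ boxes r p \ boxes r m = S ∧ S.Subsingleton,
    weight (boxes r q \ boxes r m)

open Classical in
theorem kernel_empty {r : ℕ} {q p : Fin (r + 1) → ℤ} (hq : Antitone q) (hp : Antitone p) :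
    kernel ∅ q p = if p = q then 1 else 0 := by
  rw [← sum_weight hq hp, kernel]
  refine Finset.sum_congr ?_ fun _ _ => rfl
  ext m
  simp only [Finset.mem_filter, Finset.mem_Icc, Set.sdiff_eq_empty, boxes_subset_iff,
    Set.subsingleton_empty, and_true]
  constructor
  · tauto
  · rintro ⟨⟨h1, h2⟩, h3⟩
    refine ⟨⟨fun y => ?_, h2⟩, h3, h1⟩
    have : p y ≤ m y := h1 y
    simp only [Pi.sub_apply, Pi.one_apply]
    omega

open Classical in
theorem kernel_singleton {r : ℕ} {q p : Fin (r + 1) → ℤ} (hq : Antitone q) (hp : Antitone p)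
    (x : ℤ) (y : Fin (r + 1)) :
    kernel {(x, y)} q p = if x = p y - 1 ∧ RemRow p y then
      (if dec p y = q then 1 else 0) - (if p = q then 1 else 0) else 0 := by
  by_cases hrem : x = p y - 1 ∧ RemRow p y
  · rw [if_pos hrem, ← sum_weight hq (antitone_dec hp hrem.2), ← sum_weight hq hp, kernel,
      eq_sub_iff_add_eq,
      ← Finset.sum_union]
    · refine Finset.sum_congr ?_ fun _ _ => rfl
      ext m
      simp only [Finset.mem_union, Finset.mem_filter, Finset.mem_Icc, Set.subsingleton_singleton,
        and_true]
      constructor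
      · rintro (⟨⟨h1, h2⟩, h3, h4⟩ | ⟨⟨h1, h2⟩, h3⟩)
        · rw [diff_eq_singleton_iff h3] at h4
          exact ⟨⟨h4.2.1, h2⟩, h3⟩
        · exact ⟨⟨(dec_le p y).trans h1, h2⟩, h3⟩
      · rintro ⟨⟨h1, h2⟩, h3⟩
        rw [diff_eq_singleton_iff h3]
        by_cases hpm : p ≤ m
        · exact Or.inr ⟨⟨hpm, h2⟩, h3⟩
        · refine Or.inl ⟨⟨fun z => ?_, h2⟩, h3, hrem, h1, hpm⟩
          have := h1 z
          simp only [dec] at this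
          simp only [Pi.sub_apply, Pi.one_apply]
          split_ifs at this <;> omega
    · rw [Finset.disjoint_left]
      intro m h1 h2
      rw [Finset.mem_filter, Finset.mem_Icc] at h1 h2
      have := h1.2.2.1
      rw [diff_eq_singleton_iff h1.2.1] at this
      exact this.2.2 h2.1.1
  · rw [if_neg hrem, kernel, Finset.filter_false_of_mem, Finset.sum_empty]
    rintro m - ⟨h1, h2, -⟩
    rw [diff_eq_singleton_iff h1] at h2
    exact hrem h2.1

/-- The pontableaux from `l1` to `p` whose augmentations `n` occupy the boxes of `S n`. -/
def tabPT (r : ℕ) (l1 : Fin (r + 1) → ℤ) (S : ℕ → Set (ℤ × Fin (r + 1))) (g : ℕ)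
    (p : Fin (r + 1) → ℤ) : Set (PontSeq r) :=
  {P | P ∈ PT r g l1 p ∧ ∀ n, 1 ≤ n → n ≤ g → boxes r (P.rho n) \ boxes r (P.lam n) = S n}

/-- Append a final pair `(l, p)` at position `n`. -/
def append {r : ℕ} (n : ℕ) (l p : Fin (r + 1) → ℤ) (P : PontSeq r) : PontSeq r :=
  ⟨Function.update P.lam n l, Function.update P.rho n p⟩

theorem sub_one_le_of_subsingleton {r : ℕ} {m p : Fin (r + 1) → ℤ}
    (h : (boxes r p \ boxes r m).Subsingleton) : p - 1 ≤ m := by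
  intro y
  simp only [Pi.sub_apply, Pi.one_apply]
  by_contra! hc
  have := h (x := (m y, y)) (y := (m y + 1, y)) ⟨by simp only [boxes, Set.mem_ofPred_eq]; omega,
    by simp only [boxes, Set.mem_ofPred_eq]; omega⟩ ⟨by simp only [boxes, Set.mem_ofPred_eq]; omega,
    by simp only [boxes, Set.mem_ofPred_eq]; omega⟩
  simp at this

section Recursion

variable {r : ℕ} {l1 : Fin (r + 1) → ℤ} {S : ℕ → Set (ℤ × Fin (r + 1))}

theorem antitone_of_mem_tabPT {g : ℕ} (hg : 1 ≤ g) {p : Fin (r + 1) → ℤ} {P : PontSeq r}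
    (hP : P ∈ tabPT r l1 S g p) : Antitone p := by
  obtain ⟨⟨hv, -, rfl⟩, -⟩ := hP
  exact (hv.1 g hg le_rfl).2

theorem mem_tabPT_iff {g : ℕ} {p : Fin (r + 1) → ℤ} {P : PontSeq r} :
    P ∈ tabPT r l1 S g p ↔
      (∀ n, 1 ≤ n → n ≤ g → Antitone (P.lam n) ∧ Antitone (P.rho n) ∧
        boxes r (P.rho n) \ boxes r (P.lam n) = S n ∧ (S n).Subsingleton) ∧
      (∀ n, 1 ≤ n → n + 1 ≤ g → P.lam (n + 1) ≤ P.rho n) ∧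
      (∀ n, n = 0 ∨ g < n → P.lam n = 0 ∧ P.rho n = 0) ∧ P.lam 1 = l1 ∧ P.rho g = p := by
  simp only [tabPT, PT, ValidPont, Set.mem_ofPred_eq, boxes_subset_iff]
  constructor
  · rintro ⟨⟨⟨h1, h2, h3, h4⟩, h5, h6⟩, h7⟩
    refine ⟨fun n hn hng => ⟨(h1 n hn hng).1, (h1 n hn hng).2, h7 n hn hng, ?_⟩, h2, h4, h5, h6⟩
    rw [← h7 n hn hng, ← step_iff (h1 n hn hng).2]
    simpa only [boxes_subset_iff] using h3 n hn hng
  · rintro ⟨h1, h2, h3, h4, h5⟩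
    refine ⟨⟨⟨fun n hn hng => ⟨(h1 n hn hng).1, (h1 n hn hng).2.1⟩, h2, fun n hn hng => ?_, h3⟩,
      h4, h5⟩, fun n hn hng => (h1 n hn hng).2.2.1⟩
    obtain ⟨-, h7, h8, h9⟩ := h1 n hn hng
    rw [← h8, ← step_iff h7] at h9
    simpa only [boxes_subset_iff] using h9

theorem mem_tabPT_succ {g : ℕ} (hg : 1 ≤ g) {p : Fin (r + 1) → ℤ} {P : PontSeq r} :
    P ∈ tabPT r l1 S (g + 1) p ↔ ∃ q m, (Antitone q ∧ m ≤ q ∧ Antitone m ∧ Antitone p ∧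
      boxes r p \ boxes r m = S (g + 1) ∧ (S (g + 1)).Subsingleton) ∧
      ∃ Q ∈ tabPT r l1 S g q, append (g + 1) m p Q = P := by
  constructor
  · intro hP
    rw [mem_tabPT_iff] at hP
    obtain ⟨h1, h2, h3, h4, h5⟩ := hP
    refine ⟨P.rho g, P.lam (g + 1), ⟨(h1 g hg (by omega)).2.1, h2 g hg le_rfl, ?_⟩,
      append (g + 1) 0 0 P, ?_, ?_⟩
    · have := h1 (g + 1) (by omega) le_rfl
      rw [h5] at this
      exact this
    · rw [mem_tabPT_iff]
      refine ⟨fun n hn hng => ?_, fun n hn hng => ?_, fun n hn => ?_, ?_, ?_⟩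
      · have hne : n ≠ g + 1 := by omega
        simp only [append, Function.update_of_ne hne]
        exact h1 n hn (by omega)
      · have hne : n ≠ g + 1 := by omega
        have hne' : n + 1 ≠ g + 1 := by omega
        simp only [append, Function.update_of_ne hne, Function.update_of_ne hne']
        exact h2 n hn (by omega)
      · by_cases hne : n = g + 1
        · subst hne
          simp [append]
        · simp only [append, Function.update_of_ne hne]
          exact h3 n (by omega)
      · simp only [append, Function.update_of_ne (show 1 ≠ g + 1 by omega)]
        exact h4
      · simp only [append, Function.update_of_ne (show g ≠ g + 1 by omega)]
    · simp [append, ← h5]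
  · rintro ⟨q, m, ⟨hq, hmq, hm, hp, hS, hS'⟩, Q, hQ, rfl⟩
    rw [mem_tabPT_iff] at hQ ⊢
    obtain ⟨h1, h2, h3, h4, h5⟩ := hQ
    refine ⟨fun n hn hng => ?_, fun n hn hng => ?_, fun n hn => ?_, ?_, ?_⟩
    · by_cases hne : n = g + 1
      · subst hne
        simp only [append, Function.update_self]
        exact ⟨hm, hp, hS, hS'⟩
      · simp only [append, Function.update_of_ne hne]
        exact h1 n hn (by omega)
    · have hne : n ≠ g + 1 := by omega
      by_cases hne' : n = g
      · subst hne'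
        simpa [append, h5] using hmq
      · have hne' : n + 1 ≠ g + 1 := by omega
        simp only [append, Function.update_of_ne hne, Function.update_of_ne hne']
        exact h2 n hn (by omega)
    · have hne : n ≠ g + 1 := by omega
      simp only [append, Function.update_of_ne hne]
      exact h3 n (by omega)
    · simp only [append, Function.update_of_ne (show 1 ≠ g + 1 by omega)]
      exact h4
    · simp [append]

theorem le_of_mem_tabPT {g : ℕ} (hg : 1 ≤ g) {p : Fin (r + 1) → ℤ} {P : PontSeq r}
    (hP : P ∈ tabPT r l1 S g p) : p ≤ l1 + (g : Fin (r + 1) → ℤ) := by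
  induction g, hg using Nat.le_induction generalizing p P with
  | base =>
    rw [mem_tabPT_iff] at hP
    obtain ⟨h1, -, -, rfl, rfl⟩ := hP
    obtain ⟨-, -, h3, h4⟩ := h1 1 le_rfl le_rfl
    rw [← h3] at h4
    intro y
    have := sub_one_le_of_subsingleton h4 y
    simp only [Pi.sub_apply, Pi.one_apply, Pi.add_apply, Pi.natCast_apply] at this ⊢
    omega
  | succ g hg ih =>
    rw [mem_tabPT_succ hg] at hP
    obtain ⟨q, m, ⟨-, h1, -, -, h3, h4⟩, Q, hQ, -⟩ := hP
    rw [← h3] at h4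
    intro y
    have h5 := sub_one_le_of_subsingleton h4 y
    have h6 := ih hQ y
    have h7 : m y ≤ q y := h1 y
    simp only [Pi.sub_apply, Pi.one_apply, Pi.add_apply, Pi.natCast_apply] at h5 h6 ⊢
    push_cast
    omega

open Classical in
theorem tabPT_succ_eq_biUnion {g : ℕ} (hg : 1 ≤ g) {p : Fin (r + 1) → ℤ} (hp : Antitone p) :
    tabPT r l1 S (g + 1) p =
      ⋃ d ∈ (({q ∈ Icc (p - 1) ((l1 + (g : Fin (r + 1) → ℤ)) ⊔ p) | Antitone q}.sigma fun q =>
          {m ∈ Icc (p - 1) q | Antitone m ∧ boxes r p \ boxes r m = S (g + 1) ∧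
            (S (g + 1)).Subsingleton} : Finset (Σ _ : Fin (r + 1) → ℤ, Fin (r + 1) → ℤ)) :
          Set (Σ _ : Fin (r + 1) → ℤ, Fin (r + 1) → ℤ)),
        Set.image (append (g + 1) d.2 p) (tabPT r l1 S g d.1) := by
  ext P
  rw [mem_tabPT_succ hg]
  simp only [Set.mem_iUnion, Finset.mem_coe, Finset.mem_sigma, Finset.mem_filter, Finset.mem_Icc,
    Set.mem_image,
    exists_prop, Sigma.exists]
  constructor
  · rintro ⟨q, m, ⟨h1, h2, h3, -, h4, h5⟩, Q, hQ, h6⟩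
    have h7 := sub_one_le_of_subsingleton (h4.symm ▸ h5)
    exact ⟨q, m, ⟨⟨⟨h7.trans h2, (le_of_mem_tabPT hg hQ).trans le_sup_left⟩, h1⟩, ⟨h7, h2⟩, h3,
      h4, h5⟩, Q, hQ, h6⟩
  · rintro ⟨q, m, ⟨⟨-, h1⟩, ⟨-, h2⟩, h3, h4, h5⟩, h6⟩
    exact ⟨q, m, ⟨h1, h2, h3, hp, h4, h5⟩, h6⟩

theorem tabPT_one_subset (p : Fin (r + 1) → ℤ) :
    tabPT r l1 S 1 p ⊆ {append 1 l1 p ⟨0, 0⟩} := by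
  intro P hP
  rw [mem_tabPT_iff] at hP
  obtain ⟨-, -, h3, rfl, rfl⟩ := hP
  rw [Set.mem_singleton_iff]
  obtain ⟨lam, rho⟩ := P
  simp only [append, PontSeq.mk.injEq]
  constructor <;> funext n <;> by_cases hn : n = 1
  · subst hn; simp
  · rw [Function.update_of_ne hn]
    exact (h3 n (by omega)).1
  · subst hn; simp
  · rw [Function.update_of_ne hn]
    exact (h3 n (by omega)).2

theorem finite_tabPT {g : ℕ} (hg : 1 ≤ g) (p : Fin (r + 1) → ℤ) :
    (tabPT r l1 S g p).Finite := by
  induction g, hg using Nat.le_induction generalizing p with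
  | base => exact (Set.finite_singleton _).subset (tabPT_one_subset p)
  | succ g hg ih =>
    by_cases hp : Antitone p
    · rw [tabPT_succ_eq_biUnion hg hp]
      exact Set.Finite.biUnion (Finset.finite_toSet _) fun d _ => (ih d.1).image _
    · rw [Set.eq_empty_of_forall_notMem fun P hP => hp (antitone_of_mem_tabPT (by omega) hP)]
      exact Set.finite_empty

theorem mu_append {g : ℕ} (hg : 1 ≤ g) {p m : Fin (r + 1) → ℤ} (Q : PontSeq r) :
    mu r (g + 1) (append (g + 1) m p Q) =
      mu r g Q * weight (boxes r (Q.rho g) \ boxes r m) := by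
  rw [mu_eq_prod, mu_eq_prod, Finset.prod_Icc_succ_top (by omega)]
  congr 1
  · refine Finset.prod_congr rfl fun n hn => ?_
    rw [Finset.mem_Icc] at hn
    simp only [lrs, append, Function.update_of_ne (show n ≠ g + 1 by omega),
      Function.update_of_ne (show n - 1 ≠ g + 1 by omega)]
  · simp [lrs, append]

/-- The signed count of pontableaux ending in `p` with prescribed augmentations. -/
noncomputable def signedCount (r : ℕ) (l1 : Fin (r + 1) → ℤ) (S : ℕ → Set (ℤ × Fin (r + 1)))
    (g : ℕ) (p : Fin (r + 1) → ℤ) : ℤ :=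
  ∑ᶠ P ∈ tabPT r l1 S g p, mu r g P

theorem signedCount_of_empty {g : ℕ} {p : Fin (r + 1) → ℤ} (h : ∀ P, P ∉ tabPT r l1 S g p) :
    signedCount r l1 S g p = 0 := by
  rw [signedCount, Set.eq_empty_of_forall_notMem h, finsum_mem_empty]

theorem append_injOn {g : ℕ} {q q' p m m' : Fin (r + 1) → ℤ} {Q Q' : PontSeq r}
    (hQ : Q ∈ tabPT r l1 S g q) (hQ' : Q' ∈ tabPT r l1 S g q')
    (h : append (g + 1) m p Q = append (g + 1) m' p Q') : Q = Q' ∧ m = m' := by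
  simp only [append, PontSeq.mk.injEq] at h
  rw [mem_tabPT_iff] at hQ hQ'
  have hz := hQ.2.2.1 (g + 1) (by omega)
  have hz' := hQ'.2.2.1 (g + 1) (by omega)
  have hm : m = m' := by simpa using congrFun h.1 (g + 1)
  refine ⟨?_, hm⟩
  obtain ⟨lam, rho⟩ := Q
  obtain ⟨lam', rho'⟩ := Q'
  simp only [PontSeq.mk.injEq] at *
  constructor <;> funext n <;> by_cases hn : n = g + 1
  · subst hn; rw [hz.1, hz'.1]
  · simpa [hn] using congrFun h.1 n
  · subst hn; rw [hz.2, hz'.2]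
  · simpa [hn] using congrFun h.2 n

open Classical in
theorem signedCount_succ {g : ℕ} (hg : 1 ≤ g) {p : Fin (r + 1) → ℤ} (hp : Antitone p) :
    signedCount r l1 S (g + 1) p =
      ∑ q ∈ Icc (p - 1) ((l1 + (g : Fin (r + 1) → ℤ)) ⊔ p) with Antitone q,
        signedCount r l1 S g q * kernel (S (g + 1)) q p := by
  simp only [kernel, Finset.mul_sum]
  rw [Finset.sum_sigma', signedCount, tabPT_succ_eq_biUnion hg hp,
    finsum_mem_biUnion ?_ (Finset.finite_toSet _)
      fun d _ => (finite_tabPT hg d.1).image _]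
  · rw [finsum_mem_coe_finset]
    refine Finset.sum_congr rfl fun d _ => ?_
    rw [finsum_mem_image fun Q hQ Q' hQ' h => (append_injOn hQ hQ' h).1, signedCount,
      finsum_mem_mul]
    refine finsum_mem_congr rfl fun Q hQ => ?_
    rw [mu_append hg, (mem_tabPT_iff.1 hQ).2.2.2.2]
  · rintro ⟨q, m⟩ - ⟨q', m'⟩ - hne
    rw [Function.onFun, Set.disjoint_left]
    rintro _ ⟨Q, hQ, rfl⟩ ⟨Q', hQ', h⟩
    obtain ⟨rfl, rfl⟩ := append_injOn hQ' hQ h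
    rw [mem_tabPT_iff] at hQ hQ'
    obtain rfl : q = q' := hQ.2.2.2.2.symm.trans hQ'.2.2.2.2
    exact hne rfl

theorem signedCount_succ_of_empty {g : ℕ} (hg : 1 ≤ g) {p : Fin (r + 1) → ℤ} (hp : Antitone p)
    (hS : S (g + 1) = ∅) : signedCount r l1 S (g + 1) p = signedCount r l1 S g p := by
  classical
  rw [signedCount_succ hg hp, hS, Finset.sum_eq_single p]
  · rw [kernel_empty hp hp, if_pos rfl, mul_one]
  · intro q hq hne
    rw [kernel_empty (Finset.mem_filter.1 hq).2 hp, if_neg hne.symm, mul_zero]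
  · intro h
    refine absurd ?_ h
    rw [Finset.mem_filter, Finset.mem_Icc]
    exact ⟨⟨fun y => by simp, le_sup_right⟩, hp⟩

open Classical in
theorem signedCount_succ_of_singleton {g : ℕ} (hg : 1 ≤ g) {p : Fin (r + 1) → ℤ}
    (hp : Antitone p) {x : ℤ} {y : Fin (r + 1)} (hS : S (g + 1) = {(x, y)}) :
    signedCount r l1 S (g + 1) p = if x = p y - 1 ∧ RemRow p y then
      signedCount r l1 S g (dec p y) - signedCount r l1 S g p else 0 := by
  rw [signedCount_succ hg hp, hS, Finset.sum_congr rfl fun q hq => by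
    rw [kernel_singleton (Finset.mem_filter.1 hq).2 hp]]
  split_ifs with hrem
  · simp only [mul_sub, Finset.sum_sub_distrib, mul_ite, mul_one, mul_zero, Finset.sum_ite_eq]
    rw [if_pos, if_pos]
    · rw [Finset.mem_filter, Finset.mem_Icc]
      exact ⟨⟨fun z => by simp, le_sup_right⟩, hp⟩
    · rw [Finset.mem_filter, Finset.mem_Icc]
      refine ⟨⟨fun z => ?_, (dec_le p y).trans le_sup_right⟩, antitone_dec hp hrem.2⟩
      simp only [dec, Pi.sub_apply, Pi.one_apply]
      split_ifs <;> omega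
  · simp

theorem signedCount_of_not_subsingleton {g : ℕ} (hg : 1 ≤ g) {p : Fin (r + 1) → ℤ}
    (hS : ¬ (S g).Subsingleton) : signedCount r l1 S g p = 0 :=
  signedCount_of_empty fun _ hP => hS ((mem_tabPT_iff.1 hP).1 g hg le_rfl).2.2.2

open Classical in
theorem signedCount_one (hl1 : Antitone l1) {p : Fin (r + 1) → ℤ} (hp : Antitone p) :
    signedCount r l1 S 1 p =
      if boxes r p \ boxes r l1 = S 1 ∧ (S 1).Subsingleton then 1 else 0 := by
  split_ifs with h
  · have : tabPT r l1 S 1 p = {append 1 l1 p ⟨0, 0⟩} := by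
      refine (tabPT_one_subset p).antisymm ?_
      rintro _ rfl
      rw [mem_tabPT_iff]
      refine ⟨fun n hn hn' => ?_, fun n hn hn' => by omega, fun n hn => ?_, ?_, ?_⟩
      · obtain rfl : n = 1 := by omega
        simpa [append] using ⟨hl1, hp, h⟩
      · simp [append, show n ≠ 1 by omega]
      · simp [append]
      · simp [append]
    rw [signedCount, this, finsum_mem_singleton, mu_eq_prod]
    simp
  · refine signedCount_of_empty fun P hP => h ?_
    obtain ⟨h1, -, -, h4, h5⟩ := mem_tabPT_iff.1 hP
    have := h1 1 le_rfl le_rfl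
    rw [h4, h5] at this
    exact this.2.2

end Recursion

section Tableaux

variable {r : ℕ} {l1 : Fin (r + 1) → ℤ}

/-- `t` is an almost-standard set-valued tableau on `p ∖ l1`. -/
def IsAlmostStd (l1 : Fin (r + 1) → ℤ) (t : ℤ × Fin (r + 1) → Finset ℕ)
    (p : Fin (r + 1) → ℤ) : Prop :=
  (∀ b : ℤ × Fin (r + 1), (t b).Nonempty ↔ b ∈ boxes r p \ boxes r l1) ∧
    (∀ (n : ℕ) (b b' : ℤ × Fin (r + 1)), n ∈ t b → n ∈ t b' → b = b') ∧
    (∀ (x : ℤ) (y : Fin (r + 1)), ∀ a ∈ t (x, y),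
      (∀ c ∈ t (x + 1, y), a < c) ∧
      (∀ y' : Fin (r + 1), (y' : ℕ) = (y : ℕ) + 1 → ∀ c ∈ t (x, y'), a < c))

open Classical in
/-- The sign of an almost-standard tableau, and `0` for other labelings. -/
noncomputable def tabSign (l1 : Fin (r + 1) → ℤ) (t : ℤ × Fin (r + 1) → Finset ℕ)
    (p : Fin (r + 1) → ℤ) : ℤ :=
  if IsAlmostStd l1 t p then
    (-1) ^ ({k : ℕ | ∃ b, k ∈ t b}.ncard + (boxes r p \ boxes r l1).ncard) else 0

theorem finite_diff (p l : Fin (r + 1) → ℤ) : (boxes r p \ boxes r l).Finite := by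
  refine (Set.finite_iUnion fun y : Fin (r + 1) =>
    (Set.finite_Ico (l y) (p y)).image fun x => (x, y)).subset ?_
  rintro ⟨x, y⟩ ⟨h1, h2⟩
  simp only [boxes, Set.mem_ofPred_eq, not_lt] at h1 h2
  exact Set.mem_iUnion.2 ⟨y, x, ⟨h2, h1⟩, rfl⟩

open Classical in
theorem tabSign_of_forall_eq_empty {t : ℤ × Fin (r + 1) → Finset ℕ} (ht : ∀ b, t b = ∅)
    (p : Fin (r + 1) → ℤ) : tabSign l1 t p = if p ≤ l1 then 1 else 0 := by
  by_cases h : p ≤ l1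
  · have h2 := h
    rw [← boxes_subset_iff, ← Set.sdiff_eq_empty] at h2
    rw [if_pos h, tabSign, if_pos]
    · simp [ht, h2]
    · simp [IsAlmostStd, ht, h2]
  · rw [if_neg h, tabSign, if_neg]
    rintro ⟨h2, -⟩
    rw [← boxes_subset_iff, ← Set.sdiff_eq_empty, Set.eq_empty_iff_forall_notMem] at h
    refine h fun b hb => ?_
    have := (h2 b).2 hb
    simp [ht] at this

theorem IsAlmostStd.of_insert {t t' : ℤ × Fin (r + 1) → Finset ℕ} {p q : Fin (r + 1) → ℤ}
    (hsub : ∀ b, t b ⊆ t' b) (h : IsAlmostStd l1 t' p)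
    (hq : ∀ b, (t b).Nonempty ↔ b ∈ boxes r q \ boxes r l1) : IsAlmostStd l1 t q :=
  ⟨hq, fun n b b' hb hb' => h.2.1 n b b' (hsub _ hb) (hsub _ hb'), fun x y a ha =>
    ⟨fun c hc => (h.2.2 x y a (hsub _ ha)).1 c (hsub _ hc), fun y' hy' c hc =>
      (h.2.2 x y a (hsub _ ha)).2 y' hy' c (hsub _ hc)⟩⟩

section Insert

variable {t t' : ℤ × Fin (r + 1) → Finset ℕ} {k : ℕ} {x : ℤ} {y : Fin (r + 1)}
  {p : Fin (r + 1) → ℤ}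

theorem removable_of_isAlmostStd_insert (hl1 : Antitone l1) (hp : Antitone p)
    (hlt : ∀ b, ∀ j ∈ t b, j < k)
    (ht' : ∀ b j, j ∈ t' b ↔ j ∈ t b ∨ j = k ∧ b = (x, y)) (h : IsAlmostStd l1 t' p) :
    x = p y - 1 ∧ RemRow p y := by
  have hk : k ∈ t' (x, y) := (ht' _ _).2 (Or.inr ⟨rfl, rfl⟩)
  have hle : ∀ b, ∀ j ∈ t' b, j ≤ k := by
    intro b j hj
    rcases (ht' _ _).1 hj with hj | ⟨rfl, -⟩
    · exact (hlt _ _ hj).le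
    · exact le_rfl
  have hb := (h.1 (x, y)).1 ⟨k, hk⟩
  simp only [boxes, Set.mem_sdiff, Set.mem_ofPred_eq] at hb
  constructor
  · by_contra hne
    obtain ⟨c, hc⟩ := (h.1 (x + 1, y)).2
      ⟨by simp only [boxes, Set.mem_ofPred_eq]; omega,
        by simp only [boxes, Set.mem_ofPred_eq]; omega⟩
    have h1 := (h.2.2 x y k hk).1 c hc
    have h2 := hle _ c hc
    omega
  · intro z hz
    by_contra! hc
    have hlt' : (y : ℕ) + 1 < r + 1 := by
      have := z.2
      rw [Fin.lt_def] at hz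
      omega
    let y' : Fin (r + 1) := ⟨y + 1, hlt'⟩
    have hy1 : p y ≤ p y' := hc.trans (hp (show y' ≤ z by rw [Fin.le_def]; exact hz))
    have hyy' : y ≤ y' := by rw [Fin.le_def]; simp [y']
    have hy2 := hl1 hyy'
    obtain ⟨c, hc⟩ := (h.1 (x, y')).2
      ⟨by simp only [boxes, Set.mem_ofPred_eq]; omega,
        by simp only [boxes, Set.mem_ofPred_eq]; omega⟩
    have h1 := (h.2.2 x y k hk).2 y' rfl c hc
    have h2 := hle _ c hc
    omega

theorem isAlmostStd_insert_iff (hlt : ∀ b, ∀ j ∈ t b, j < k)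
    (ht' : ∀ b j, j ∈ t' b ↔ j ∈ t b ∨ j = k ∧ b = (x, y)) (hx : x = p y - 1)
    (hrem : RemRow p y) :
    IsAlmostStd l1 t' p ↔ (x, y) ∉ boxes r l1 ∧
      (IsAlmostStd l1 t (dec p y) ∨ IsAlmostStd l1 t p) := by
  have hne : ∀ b, (t' b).Nonempty ↔ (t b).Nonempty ∨ b = (x, y) := by
    intro b
    simp only [Finset.Nonempty, ht', exists_or, exists_eq_left]
  have hdec : ∀ b, b ∈ boxes r (dec p y) ↔ b ∈ boxes r p ∧ b ≠ (x, y) := by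
    intro b
    rw [mem_boxes_dec, hx]
  have hbp : (x, y) ∈ boxes r p := by
    simp only [boxes, Set.mem_ofPred_eq]
    omega
  constructor
  · intro h
    have hb : (x, y) ∉ boxes r l1 := ((h.1 (x, y)).1 ((hne _).2 (Or.inr rfl))).2
    have hsub : ∀ b, t b ⊆ t' b := fun b j hj => (ht' b j).2 (Or.inl hj)
    refine ⟨hb, ?_⟩
    by_cases htb : (t (x, y)).Nonempty
    · refine Or.inr (h.of_insert hsub fun b => ?_)
      rw [← h.1 b, hne]
      constructor
      · exact Or.inl
      · rintro (h1 | rfl)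
        · exact h1
        · exact htb
    · refine Or.inl (h.of_insert hsub fun b => ?_)
      have h1 := h.1 b
      rw [hne] at h1
      rw [Set.mem_sdiff] at h1 ⊢
      rw [hdec]
      by_cases h2 : b = (x, y)
      · subst h2
        tauto
      · tauto
  · rintro ⟨hb, h⟩
    have hmem : ∀ b, (t b).Nonempty → b ∈ boxes r p := by
      intro b htb
      rcases h with h | h
      · exact ((hdec b).1 ((h.1 b).1 htb).1).1
      · exact ((h.1 b).1 htb).1
    refine ⟨fun b => ?_, fun n b b' hn hn' => ?_, fun x' y' a ha => ⟨fun c hc => ?_,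
      fun y'' hy'' c hc => ?_⟩⟩
    · rw [hne]
      rcases h with h | h
      · rw [h.1 b, Set.mem_sdiff, Set.mem_sdiff, hdec]
        by_cases h2 : b = (x, y)
        · subst h2
          tauto
        · tauto
      · rw [h.1 b, Set.mem_sdiff]
        by_cases h2 : b = (x, y)
        · subst h2
          tauto
        · tauto
    · rw [ht'] at hn hn'
      rcases hn with hn | ⟨rfl, rfl⟩ <;> rcases hn' with hn' | ⟨h1, rfl⟩
      · exact h.elim (fun h => h.2.1 n b b' hn hn') fun h => h.2.1 n b b' hn hn'
      · exact absurd (hlt _ _ hn) (by omega)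
      · exact absurd (hlt _ _ hn') (by omega)
      · rfl
    · rw [ht'] at ha hc
      rcases hc with hc | ⟨rfl, h2⟩ <;> rcases ha with ha | ⟨rfl, h1⟩
      · exact h.elim (fun h => (h.2.2 x' y' a ha).1 c hc) fun h => (h.2.2 x' y' a ha).1 c hc
      · have := hmem _ ⟨c, hc⟩
        simp only [Prod.mk.injEq] at h1
        obtain ⟨rfl, rfl⟩ := h1
        simp only [boxes, Set.mem_ofPred_eq] at this
        omega
      · exact hlt _ _ ha
      · simp only [Prod.mk.injEq] at h1 h2
        omega
    · rw [ht'] at ha hc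
      rcases hc with hc | ⟨rfl, h2⟩ <;> rcases ha with ha | ⟨rfl, h1⟩
      · exact h.elim (fun h => (h.2.2 x' y' a ha).2 y'' hy'' c hc) fun h =>
          (h.2.2 x' y' a ha).2 y'' hy'' c hc
      · have := hmem _ ⟨c, hc⟩
        simp only [Prod.mk.injEq] at h1
        obtain ⟨rfl, rfl⟩ := h1
        have h3 := hrem y'' (by rw [Fin.lt_def]; omega)
        simp only [boxes, Set.mem_ofPred_eq] at this
        omega
      · exact hlt _ _ ha
      · simp only [Prod.mk.injEq] at h1 h2
        obtain ⟨-, rfl⟩ := h1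
        obtain ⟨-, rfl⟩ := h2
        omega

open Classical in
theorem tabSign_insert (hl1 : Antitone l1) (hp : Antitone p)
    (hlt : ∀ b, ∀ j ∈ t b, j < k)
    (ht' : ∀ b j, j ∈ t' b ↔ j ∈ t b ∨ j = k ∧ b = (x, y)) :
    tabSign l1 t' p = if x = p y - 1 ∧ RemRow p y then
      tabSign l1 t (dec p y) - tabSign l1 t p else 0 := by
  by_cases hrem : x = p y - 1 ∧ RemRow p y
  swap
  · rw [if_neg hrem, tabSign,
      if_neg fun h => hrem (removable_of_isAlmostStd_insert hl1 hp hlt ht' h)]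
  rw [if_pos hrem]
  have hiff := isAlmostStd_insert_iff (l1 := l1) hlt ht' hrem.1 hrem.2
  have hdec : ∀ b, b ∈ boxes r (dec p y) ↔ b ∈ boxes r p ∧ b ≠ (x, y) := by
    intro b
    rw [mem_boxes_dec, hrem.1]
  have hbp : (x, y) ∈ boxes r p := by
    simp only [boxes, Set.mem_ofPred_eq]
    omega
  have hsymb : {j : ℕ | ∃ b, j ∈ t' b}.ncard = {j : ℕ | ∃ b, j ∈ t b}.ncard + 1 := by
    have h1 : {j : ℕ | ∃ b, j ∈ t' b} = insert k {j : ℕ | ∃ b, j ∈ t b} := by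
      ext j
      simp only [Set.mem_ofPred_eq, Set.mem_insert_iff, ht', exists_or, exists_and_left,
        exists_eq, and_true]
      tauto
    have hfin : {j : ℕ | ∃ b, j ∈ t b}.Finite := by
      refine (Set.finite_lt_nat k).subset ?_
      rintro j ⟨b, hb⟩
      exact hlt _ _ hb
    rw [h1, Set.ncard_insert_of_notMem _ hfin]
    rintro ⟨b, hb⟩
    exact lt_irrefl _ (hlt _ _ hb)
  by_cases hb : (x, y) ∈ boxes r l1
  · have hdiff : boxes r (dec p y) \ boxes r l1 = boxes r p \ boxes r l1 := by
      ext b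
      rw [Set.mem_sdiff, Set.mem_sdiff, hdec]
      constructor
      · tauto
      · rintro ⟨h1, h2⟩
        exact ⟨⟨h1, fun h3 => h2 (h3 ▸ hb)⟩, h2⟩
    have hstd : IsAlmostStd l1 t (dec p y) ↔ IsAlmostStd l1 t p := by
      simp only [IsAlmostStd, hdiff]
    simp only [tabSign, hdiff, hstd, sub_self]
    exact if_neg fun h => (hiff.1 h).1 hb
  · have hdiff : boxes r p \ boxes r l1 = insert (x, y) (boxes r (dec p y) \ boxes r l1) := by
      ext b
      rw [Set.mem_insert_iff, Set.mem_sdiff, Set.mem_sdiff, hdec]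
      by_cases h2 : b = (x, y)
      · subst h2
        tauto
      · tauto
    have hcard : (boxes r p \ boxes r l1).ncard = (boxes r (dec p y) \ boxes r l1).ncard + 1 := by
      rw [hdiff, Set.ncard_insert_of_notMem _ (finite_diff _ _)]
      rintro ⟨h1, -⟩
      exact ((hdec _).1 h1).2 rfl
    have hexcl : ¬ (IsAlmostStd l1 t (dec p y) ∧ IsAlmostStd l1 t p) := by
      rintro ⟨h1, h2⟩
      have h3 := (h1.1 (x, y)).1 ((h2.1 (x, y)).2 ⟨hbp, hb⟩)
      exact ((hdec _).1 h3.1).2 rfl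
    simp only [tabSign, hsymb, hcard, hiff]
    by_cases h1 : IsAlmostStd l1 t (dec p y) <;> by_cases h2 : IsAlmostStd l1 t p
    · exact absurd ⟨h1, h2⟩ hexcl
    · simp only [hb, h1, h2, not_false_eq_true, or_false, and_self, if_true, if_false]
      ring
    · simp only [hb, h1, h2, not_false_eq_true, or_true, and_self, if_true, if_false]
      ring
    · simp [h1, h2]

end Insert

/-- The labels of `t` that are at most `n`. -/
def truncate (t : ℤ × Fin (r + 1) → Finset ℕ) (n : ℕ) : ℤ × Fin (r + 1) → Finset ℕ :=
  fun b => {k ∈ t b | k ≤ n}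

section Truncate

variable {t : ℤ × Fin (r + 1) → Finset ℕ} {p : Fin (r + 1) → ℤ}

theorem tabSign_truncate_succ_of_empty {n : ℕ} (h : {b | n + 1 ∈ t b} = ∅) :
    tabSign l1 (truncate t (n + 1)) p = tabSign l1 (truncate t n) p := by
  congr 1
  funext b
  ext j
  simp only [truncate, Finset.mem_filter, and_congr_right_iff]
  intro hj
  have : j ≠ n + 1 := by
    rintro rfl
    exact (Set.eq_empty_iff_forall_notMem.1 h) b hj
  omega

open Classical in
theorem tabSign_truncate_succ_of_singleton {n : ℕ} (hl1 : Antitone l1) (hp : Antitone p)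
    {x : ℤ} {y : Fin (r + 1)} (h : {b | n + 1 ∈ t b} = {(x, y)}) :
    tabSign l1 (truncate t (n + 1)) p = if x = p y - 1 ∧ RemRow p y then
      tabSign l1 (truncate t n) (dec p y) - tabSign l1 (truncate t n) p else 0 := by
  refine tabSign_insert (k := n + 1) hl1 hp ?_ ?_
  · intro b j hj
    have := (Finset.mem_filter.1 hj).2
    omega
  · intro b j
    have hb : n + 1 ∈ t b ↔ b = (x, y) := Set.ext_iff.1 h b
    simp only [truncate, Finset.mem_filter]
    by_cases hj : j = n + 1
    · subst hj
      simp [hb]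
    · simp only [hj, false_and, or_false, and_congr_right_iff]
      omega

theorem tabSign_truncate_of_not_subsingleton {n : ℕ} (h : ¬ {b | n ∈ t b}.Subsingleton) :
    tabSign l1 (truncate t n) p = 0 := by
  refine if_neg fun hstd => h fun b hb b' hb' => hstd.2.1 n b b' ?_ ?_
  · exact Finset.mem_filter.2 ⟨hb, le_rfl⟩
  · exact Finset.mem_filter.2 ⟨hb', le_rfl⟩

open Classical in
theorem tabSign_truncate_one (hl1 : Antitone l1) (hp : Antitone p) (ht : ∀ b, 0 ∉ t b) :
    tabSign l1 (truncate t 1) p =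
      if boxes r p \ boxes r l1 = {b | 1 ∈ t b} ∧ {b | 1 ∈ t b}.Subsingleton then 1 else 0 := by
  have h0 : ∀ b, truncate t 0 b = ∅ := by
    intro b
    rw [truncate, Finset.filter_eq_empty_iff]
    intro k hk hk0
    obtain rfl : k = 0 := by omega
    exact ht b hk
  by_cases hS : {b | 1 ∈ t b}.Subsingleton
  · rcases hS.eq_empty_or_singleton with he | ⟨⟨x, y⟩, he⟩
    · rw [tabSign_truncate_succ_of_empty he, tabSign_of_forall_eq_empty h0, he]
      simp only [Set.sdiff_eq_empty, boxes_subset_iff, Set.subsingleton_empty, and_true]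
    · rw [tabSign_truncate_succ_of_singleton hl1 hp he, tabSign_of_forall_eq_empty h0,
        tabSign_of_forall_eq_empty h0, he]
      simp only [diff_eq_singleton_iff hl1, Set.subsingleton_singleton, and_true]
      have hle : p ≤ l1 → dec p y ≤ l1 := (dec_le p y).trans
      by_cases h1 : x = p y - 1 ∧ RemRow p y <;> by_cases h2 : p ≤ l1 <;>
        by_cases h3 : dec p y ≤ l1 <;> simp_all
  · rw [tabSign_truncate_of_not_subsingleton hS, if_neg fun h => hS h.2]

theorem signedCount_eq_tabSign {g : ℕ} (hg : 1 ≤ g) (hl1 : Antitone l1) (hp : Antitone p)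
    (ht : ∀ b, 0 ∉ t b) :
    signedCount r l1 (fun n => {b | n ∈ t b}) g p = tabSign l1 (truncate t g) p := by
  classical
  induction g, hg using Nat.le_induction generalizing p with
  | base => rw [signedCount_one hl1 hp, tabSign_truncate_one hl1 hp ht]
  | succ g hg ih =>
    by_cases hS : {b | g + 1 ∈ t b}.Subsingleton
    · rcases hS.eq_empty_or_singleton with he | ⟨⟨x, y⟩, he⟩
      · rw [signedCount_succ_of_empty hg hp he, tabSign_truncate_succ_of_empty he, ih hp]
      · rw [signedCount_succ_of_singleton hg hp he, tabSign_truncate_succ_of_singleton hl1 hp he]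
        refine if_ctx_congr Iff.rfl (fun h => ?_) fun _ => rfl
        rw [ih hp, ih (antitone_dec hp h.2)]
    · rw [signedCount_of_not_subsingleton (by omega) hS, tabSign_truncate_of_not_subsingleton hS]

end Truncate

theorem IsAlmostStd.ncard_le {t : ℤ × Fin (r + 1) → Finset ℕ} {p : Fin (r + 1) → ℤ} {g : ℕ}
    (ht : ∀ b, ∀ k ∈ t b, k ≤ g) (h : IsAlmostStd l1 t p) :
    (boxes r p \ boxes r l1).ncard ≤ {k : ℕ | ∃ b, k ∈ t b}.ncard := by
  choose! f hf using fun b hb => (h.1 b).2 hb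
  refine Set.ncard_le_ncard_of_injOn f (fun b hb => ⟨b, hf b hb⟩) ?_ ?_
  · intro b hb b' hb' hbb'
    exact h.2.1 _ b b' (hf b hb) (hbb' ▸ hf b' hb')
  · refine (Set.finite_le_nat g).subset ?_
    rintro k ⟨b, hb⟩
    exact ht b k hb

end Tableaux

end Pont

open Classical Pont in
/-- **Lemma.**  Fix `r ≥ 0`, `g ≥ 1`, nonincreasing tuples `λ¹, ρᵍ`, and let
`σ = ρᵍ ∖ λ¹`.  For any assignment `t` of finite subsets of `{1,…,g}` to the boxes, with
`N` distinct symbols, the sum of `μ(P)` over all pontableaux `P ∈ PT(λ¹,ρᵍ)` with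
underlying set-valued labeling `tab(P) = t` equals `(−1)^{N−|σ|}` if `t` is an
almost-standard set-valued tableau on `σ`, and `0` otherwise. -/
theorem stmt_3 (r g : ℕ) (hg : 1 ≤ g) (l1 rg : Fin (r + 1) → ℤ)
    (hl1 : Antitone l1) (hrg : Antitone rg)
    (t : ℤ × Fin (r + 1) → Finset ℕ) (ht : ∀ b, ∀ k ∈ t b, 1 ≤ k ∧ k ≤ g) :
    (∑ᶠ P ∈ {P : PontSeq r | P ∈ PT r g l1 rg ∧
        ∀ (b : ℤ × Fin (r + 1)) (n : ℕ),
          n ∈ t b ↔ 1 ≤ n ∧ n ≤ g ∧ b ∈ boxes r (P.rho n) ∧ b ∉ boxes r (P.lam n)},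
      mu r g P) =
    if ((∀ b : ℤ × Fin (r + 1), (t b).Nonempty ↔ b ∈ boxes r rg \ boxes r l1) ∧
        (∀ (n : ℕ) (b b' : ℤ × Fin (r + 1)), n ∈ t b → n ∈ t b' → b = b') ∧
        (∀ (x : ℤ) (y : Fin (r + 1)), ∀ a ∈ t (x, y),
          (∀ c ∈ t (x + 1, y), a < c) ∧
          (∀ y' : Fin (r + 1), (y' : ℕ) = (y : ℕ) + 1 → ∀ c ∈ t (x, y'), a < c)))
    then (-1 : ℤ) ^ ({k : ℕ | ∃ b, k ∈ t b}.ncard - (boxes r rg \ boxes r l1).ncard)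
    else 0 := by
  have hcongr : (∑ᶠ P ∈ {P : PontSeq r | P ∈ PT r g l1 rg ∧
        ∀ (b : ℤ × Fin (r + 1)) (n : ℕ),
          n ∈ t b ↔ 1 ≤ n ∧ n ≤ g ∧ b ∈ boxes r (P.rho n) ∧ b ∉ boxes r (P.lam n)},
      mu r g P) = signedCount r l1 (fun n => {b | n ∈ t b}) g rg := by
    refine finsum_mem_congr (Set.ext fun P => and_congr_right fun _ => ?_) fun _ _ => rfl
    constructor
    · intro h n hn hng
      ext b
      rw [Set.mem_ofPred_eq, h b n, Set.mem_sdiff]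
      tauto
    · intro h b n
      constructor
      · intro hb
        obtain ⟨h1, h2⟩ := ht b n hb
        have h3 : b ∈ boxes r (P.rho n) \ boxes r (P.lam n) := by
          rw [h n h1 h2]
          exact hb
        exact ⟨h1, h2, h3⟩
      · rintro ⟨h1, h2, h3⟩
        have h4 : b ∈ boxes r (P.rho n) \ boxes r (P.lam n) := h3
        rwa [h n h1 h2] at h4
  have htrunc : truncate t g = t := by
    funext b
    exact Finset.filter_true_of_mem fun k hk => (ht b k hk).2
  rw [hcongr, signedCount_eq_tabSign hg hl1 hrg fun b hb => absurd (ht b 0 hb).1 (by omega),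
    htrunc]
  refine if_ctx_congr Iff.rfl (fun h => ?_) fun _ => rfl
  have hle := IsAlmostStd.ncard_le (fun b k hk => (ht b k hk).2) h
  obtain ⟨d, hd⟩ := Nat.exists_eq_add_of_le hle
  rw [hd, Nat.add_sub_cancel_left, add_right_comm, pow_add, Even.neg_one_pow ⟨_, rfl⟩, one_mul]
end

section
/- Let d ≥ 1. A pair (σ,τ) ∈ S_d × S_d is coherent if and only if (σ,τ) and (ω, id) are related by a finite sequence of moves, where ω = (d−1, d−2, …, 0) is the descending permutation and id = (0, 1, …, d−1) is the identity. -/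
namespace Coh

/-- The first `k` values `(σ_0, …, σ_{k−1})` of a permutation of `Fin d`, sorted
increasingly. -/
def sortedFirst (d : ℕ) (σ : Equiv.Perm (Fin d)) (k : ℕ) : List ℕ :=
  List.insertionSort (· ≤ ·) (((List.finRange d).take k).map fun i => (σ i : ℕ))

/-- `(σ,τ)` is `k`-coherent: with `s`, `t` the increasing rearrangements of the first `k`
values of `σ`, `τ`, one has `s_i + t_{k−1−i} < d` for all `0 ≤ i ≤ k−1`. -/
def KCoherent (d : ℕ) (σ τ : Equiv.Perm (Fin d)) (k : ℕ) : Prop :=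
  ∀ i : ℕ, i < k →
    (sortedFirst d σ k).getD i 0 + (sortedFirst d τ k).getD (k - 1 - i) 0 < d

/-- `(σ,τ)` is coherent: it is `k`-coherent for all `k = 1, …, d`. -/
def Coherent (d : ℕ) (σ τ : Equiv.Perm (Fin d)) : Prop :=
  ∀ k : ℕ, 1 ≤ k → k ≤ d → KCoherent d σ τ k

/-- A move on a pair of permutations: if `σ_i < σ_{i+1}` exchange `τ_i` and `τ_{i+1}`,
or if `τ_i < τ_{i+1}` exchange `σ_i` and `σ_{i+1}`. -/
def IsMove (d : ℕ) (p q : Equiv.Perm (Fin d) × Equiv.Perm (Fin d)) : Prop :=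
  ∃ i : ℕ, ∃ h : i + 1 < d,
    (p.1 ⟨i, by omega⟩ < p.1 ⟨i + 1, h⟩ ∧
      q = (p.1, p.2 * Equiv.swap ⟨i, by omega⟩ ⟨i + 1, h⟩)) ∨
    (p.2 ⟨i, by omega⟩ < p.2 ⟨i + 1, h⟩ ∧
      q = (p.1 * Equiv.swap ⟨i, by omega⟩ ⟨i + 1, h⟩, p.2))

/-- The number of positions below `k` at which `σ` takes a value below `a`. -/
def countLT (d : ℕ) (σ : Equiv.Perm (Fin d)) (k a : ℕ) : ℕ :=
  (((List.finRange d).take k).map fun i => (σ i : ℕ)).countP (· < a)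

/-- Coherence expressed by counting small values instead of sorting. -/
def CountCoherent (d : ℕ) (σ τ : Equiv.Perm (Fin d)) : Prop :=
  ∀ k : ℕ, k ≤ d → ∀ a b : ℕ, a + b = d → k ≤ countLT d σ k a + countLT d τ k b

lemma CountCoherent.symm {d : ℕ} {σ τ : Equiv.Perm (Fin d)} (h : CountCoherent d σ τ) :
    CountCoherent d τ σ := fun k hk a b hab => by
  have := h k hk b a (by omega)
  omega

lemma getD_lt_iff_lt_countP {l : List ℕ} (hl : l.Pairwise (· ≤ ·)) (b : ℕ) {j : ℕ}
    (hj : j < l.length) : l.getD j 0 < b ↔ j < l.countP (· < b) := by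
  induction l generalizing j with
  | nil => simp at hj
  | cons x l ih =>
    rw [List.pairwise_cons] at hl
    by_cases hx : x < b
    · cases j with
      | zero => simp [hx]
      | succ j =>
        have := ih hl.2 (j := j) (by simpa using hj)
        simpa [hx] using this
    · have h0 : l.countP (· < b) = 0 := by
        rw [List.countP_eq_zero]
        intro y hy
        have := hl.1 y hy
        simp only [decide_eq_true_eq]
        omega
      have hmem : x ≤ (x :: l).getD j 0 := by
        cases j with
        | zero => simp
        | succ j =>
          have hj' : j < l.length := by simpa using hj
          have := hl.1 _ (List.getElem_mem hj')
          simpa [hj'] using this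
      have : (x :: l).countP (· < b) = 0 := by simp [h0, hx]
      omega

lemma length_sortedFirst {d k : ℕ} (hk : k ≤ d) (σ : Equiv.Perm (Fin d)) :
    (sortedFirst d σ k).length = k := by
  simp [sortedFirst, hk]

lemma sortedFirst_getD_lt_iff {d k : ℕ} (hk : k ≤ d) (σ : Equiv.Perm (Fin d)) (b : ℕ) {j : ℕ}
    (hj : j < k) : (sortedFirst d σ k).getD j 0 < b ↔ j < countLT d σ k b := by
  have hp : countLT d σ k b = (sortedFirst d σ k).countP (· < b) :=
    ((List.perm_insertionSort _ _).countP_eq _).symm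
  rw [hp]
  exact getD_lt_iff_lt_countP (List.pairwise_insertionSort _ _) b
    (hj.trans_eq (length_sortedFirst hk σ).symm)

lemma countLT_succ {d k : ℕ} (hk : k < d) (σ : Equiv.Perm (Fin d)) (a : ℕ) :
    countLT d σ (k + 1) a = countLT d σ k a + if (σ ⟨k, hk⟩ : ℕ) < a then 1 else 0 := by
  simp [countLT, List.take_add_one, hk, List.countP_cons]

lemma countLT_congr {d k : ℕ} (hk : k ≤ d) {σ τ : Equiv.Perm (Fin d)}
    (h : ∀ j : Fin d, (j : ℕ) < k → σ j = τ j) (a : ℕ) : countLT d σ k a = countLT d τ k a := by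
  induction k with
  | zero => simp [countLT]
  | succ k ih =>
    rw [countLT_succ hk, countLT_succ hk, ih (by omega) fun j hj => h j (by omega),
      h ⟨k, hk⟩ (by simp)]

lemma coherent_iff_countCoherent {d : ℕ} {σ τ : Equiv.Perm (Fin d)} :
    Coherent d σ τ ↔ CountCoherent d σ τ := by
  constructor
  · intro h k hk a b hab
    by_contra! hlt
    have hi : countLT d σ k a < k := by omega
    have hs := (sortedFirst_getD_lt_iff hk σ a hi).not.2 (lt_irrefl _)
    have ht := (sortedFirst_getD_lt_iff hk τ b
      (j := k - 1 - countLT d σ k a) (by omega)).not.2 (by omega)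
    have := h k (by omega) hk _ hi
    omega
  · intro h k _ hk i hi
    by_contra! hge
    by_cases hs : (sortedFirst d σ k).getD i 0 ≤ d
    · have h₁ := (sortedFirst_getD_lt_iff hk σ _ hi).not.1
        (lt_irrefl ((sortedFirst d σ k).getD i 0))
      have h₂ := (sortedFirst_getD_lt_iff hk τ (d - (sortedFirst d σ k).getD i 0)
        (j := k - 1 - i) (by omega)).not.1 (by omega)
      have := h k hk _ (d - (sortedFirst d σ k).getD i 0) (Nat.add_sub_cancel' hs)
      omega
    · have h₁ := (sortedFirst_getD_lt_iff hk σ d hi).not.1 (by omega)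
      have := h k hk d 0 rfl
      have h₂ := (sortedFirst_getD_lt_iff hk τ 0 (j := k - 1 - i) (by omega)).not.1 (by omega)
      omega

lemma countLT_mul_swap_of_ne {d i k : ℕ} (hi : i + 1 < d) (hk : k ≤ d) (hne : k ≠ i + 1)
    (τ : Equiv.Perm (Fin d)) (a : ℕ) :
    countLT d (τ * Equiv.swap ⟨i, by omega⟩ ⟨i + 1, hi⟩) k a = countLT d τ k a := by
  have hlow : ∀ m ≤ i,
      countLT d (τ * Equiv.swap ⟨i, by omega⟩ ⟨i + 1, hi⟩) m a = countLT d τ m a := by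
    intro m hm
    refine countLT_congr (by omega) (fun j hj => ?_) a
    rw [Equiv.Perm.mul_apply, Equiv.swap_apply_of_ne_of_ne] <;> simp [Fin.ext_iff] <;> omega
  rcases Nat.lt_or_ge i k with h | h
  · obtain ⟨m, rfl⟩ := Nat.exists_eq_add_of_le (show i + 2 ≤ k by omega)
    clear h hne
    induction m with
    | zero =>
      rw [add_zero, countLT_succ hi, countLT_succ (by omega : i < d), countLT_succ hi,
        countLT_succ (by omega : i < d), hlow i le_rfl]
      simp only [Equiv.Perm.mul_apply, Equiv.swap_apply_left, Equiv.swap_apply_right]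
      omega
    | succ m ih =>
      have hm : i + 2 + m < d := by omega
      rw [← add_assoc, countLT_succ hm, countLT_succ hm, ih (by omega) hlow, Equiv.Perm.mul_apply,
        Equiv.swap_apply_of_ne_of_ne] <;> simp only [ne_eq, Fin.mk.injEq] <;> omega
  · exact hlow k h

lemma CountCoherent.mul_swap_right {d i : ℕ} {σ τ : Equiv.Perm (Fin d)}
    (h : CountCoherent d σ τ) (hi : i + 1 < d) (hσ : σ ⟨i, by omega⟩ < σ ⟨i + 1, hi⟩) :
    CountCoherent d σ (τ * Equiv.swap ⟨i, by omega⟩ ⟨i + 1, hi⟩) := by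
  intro k hk a b hab
  by_cases hne : k = i + 1
  · subst hne
    have h₀ := h i (by omega) a b hab
    have h₂ := h (i + 2) (by omega) a b hab
    rw [countLT_succ hi, countLT_succ (by omega : i < d), countLT_succ hi,
      countLT_succ (by omega : i < d)] at h₂
    rw [countLT_succ (by omega : i < d), countLT_succ (by omega : i < d),
      countLT_mul_swap_of_ne hi (by omega) (by omega), Equiv.Perm.mul_apply,
      Equiv.swap_apply_left]
    rw [Fin.lt_def] at hσ
    split_ifs at h₂ ⊢ <;> omega
  · rw [countLT_mul_swap_of_ne hi hk hne]
    exact h k hk a b hab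

lemma IsMove.symm {d : ℕ} {p q : Equiv.Perm (Fin d) × Equiv.Perm (Fin d)} (h : IsMove d p q) :
    IsMove d q p := by
  obtain ⟨i, hi, ⟨hlt, rfl⟩ | ⟨hlt, rfl⟩⟩ := h
  · exact ⟨i, hi, Or.inl ⟨hlt, by simp [mul_assoc]⟩⟩
  · exact ⟨i, hi, Or.inr ⟨hlt, by simp [mul_assoc]⟩⟩

lemma CountCoherent.of_isMove {d : ℕ} {p q : Equiv.Perm (Fin d) × Equiv.Perm (Fin d)}
    (h : CountCoherent d p.1 p.2) (hpq : IsMove d p q) : CountCoherent d q.1 q.2 := by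
  obtain ⟨i, hi, ⟨hlt, rfl⟩ | ⟨hlt, rfl⟩⟩ := hpq
  · exact h.mul_swap_right hi hlt
  · exact (h.symm.mul_swap_right hi hlt).symm

lemma CountCoherent.of_reflTransGen {d : ℕ} {p q : Equiv.Perm (Fin d) × Equiv.Perm (Fin d)}
    (h : CountCoherent d p.1 p.2) (hpq : Relation.ReflTransGen (IsMove d) p q) :
    CountCoherent d q.1 q.2 := by
  induction hpq with
  | refl => exact h
  | tail _ hm ih => exact ih.of_isMove hm

lemma perm_eq_of_forall_le {d : ℕ} {σ τ : Equiv.Perm (Fin d)} (h : ∀ i, σ i ≤ τ i) : σ = τ := by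
  have hsum : ∑ i, (σ i : ℕ) = ∑ i, (τ i : ℕ) :=
    (Equiv.sum_comp σ fun i => (i : ℕ)).trans (Equiv.sum_comp τ fun i => (i : ℕ)).symm
  have := (Finset.sum_eq_sum_iff_of_le fun i _ => Fin.le_def.1 (h i)).1 hsum
  exact Equiv.ext fun i => Fin.ext (this i (Finset.mem_univ i))

lemma sum_mul_swap_lt {d : ℕ} {σ : Equiv.Perm (Fin d)} {p q : Fin d} (hpq : p < q)
    (hσ : σ p < σ q) :
    ∑ i : Fin d, (i : ℕ) * ((σ * Equiv.swap p q) i : ℕ) < ∑ i : Fin d, (i : ℕ) * (σ i : ℕ) := by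
  zify
  rw [← sub_pos, ← Finset.sum_sub_distrib, Fintype.sum_eq_add p q hpq.ne]
  · simp only [Function.comp_apply, Equiv.swap_apply_left, Equiv.swap_apply_right]
    rw [Fin.lt_def] at hpq hσ
    zify at hpq hσ
    nlinarith [mul_pos (sub_pos.2 hpq) (sub_pos.2 hσ)]
  · rintro x ⟨hp, hq⟩
    simp [Equiv.swap_apply_of_ne_of_ne hp hq]

lemma eq_of_forall_not_ascent {d : ℕ} {σ ω : Equiv.Perm (Fin d)}
    (hω : ∀ i : Fin d, (ω i : ℕ) = d - 1 - (i : ℕ))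
    (h : ∀ (i : ℕ) (hi : i + 1 < d), ¬ σ ⟨i, by omega⟩ < σ ⟨i + 1, hi⟩) : σ = ω := by
  have key : ∀ (i : ℕ) (hi : i < d), (σ ⟨i, hi⟩ : ℕ) + i < d := by
    intro i
    induction i with
    | zero => intro hi; simp
    | succ i ih =>
      intro hi
      have h₁ := ih (by omega)
      have h₂ : σ ⟨i + 1, hi⟩ < σ ⟨i, by omega⟩ :=
        lt_of_le_of_ne (not_lt.1 (h i hi)) fun he => by simpa using σ.injective he
      rw [Fin.lt_def] at h₂
      omega
  refine perm_eq_of_forall_le fun i => Fin.le_def.2 ?_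
  have := key i i.2
  rw [hω]
  simp only [Fin.eta] at this
  omega

/-- Moves can raise the first permutation of any pair to the descending one. -/
lemma exists_reflTransGen_descending {d : ℕ} {ω : Equiv.Perm (Fin d)}
    (hω : ∀ i : Fin d, (ω i : ℕ) = d - 1 - (i : ℕ)) (σ τ : Equiv.Perm (Fin d)) :
    ∃ τ', Relation.ReflTransGen (IsMove d) (σ, τ) (ω, τ') := by
  induction hn : ∑ i : Fin d, (i : ℕ) * (σ i : ℕ) using Nat.strong_induction_on
    generalizing σ τ with
  | _ n ih =>
    by_cases h : ∀ (i : ℕ) (hi : i + 1 < d), ¬ σ ⟨i, by omega⟩ < σ ⟨i + 1, hi⟩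
    · rw [eq_of_forall_not_ascent hω h]
      exact ⟨τ, .refl⟩
    push Not at h
    obtain ⟨i, hi, hlt⟩ := h
    have hstep : ∃ τ₁, Relation.ReflTransGen (IsMove d) (σ, τ) (σ, τ₁) ∧
        τ₁ ⟨i, by omega⟩ < τ₁ ⟨i + 1, hi⟩ := by
      by_cases hτ : τ ⟨i, by omega⟩ < τ ⟨i + 1, hi⟩
      · exact ⟨τ, .refl, hτ⟩
      · refine ⟨_, .single ⟨i, hi, Or.inl ⟨hlt, rfl⟩⟩, ?_⟩
        simp only [Equiv.Perm.mul_apply, Equiv.swap_apply_left, Equiv.swap_apply_right]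
        exact lt_of_le_of_ne (not_lt.1 hτ) fun he => by simpa using τ.injective he
    obtain ⟨τ₁, hmoves, hτ₁⟩ := hstep
    obtain ⟨τ', hτ'⟩ := ih _ (hn ▸ sum_mul_swap_lt (by simp [Fin.lt_def]) hlt) _ τ₁ rfl
    exact ⟨τ', (hmoves.tail ⟨i, hi, Or.inr ⟨hτ₁, rfl⟩⟩).trans hτ'⟩

lemma countCoherent_descending_one {d : ℕ} {ω : Equiv.Perm (Fin d)}
    (hω : ∀ i : Fin d, (ω i : ℕ) = d - 1 - (i : ℕ)) : CountCoherent d ω 1 := by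
  intro k hk a b hab
  induction k with
  | zero => simp
  | succ k ih =>
    have := ih (by omega)
    rw [countLT_succ hk, countLT_succ hk, hω, Equiv.Perm.one_apply]
    dsimp only
    split_ifs <;> omega

lemma countLT_le {d k : ℕ} (hk : k ≤ d) (σ : Equiv.Perm (Fin d)) (a : ℕ) :
    countLT d σ k a ≤ k := by
  refine List.countP_le_length.trans ?_
  simp [hk]

lemma CountCoherent.eq_one {d : ℕ} {ω τ : Equiv.Perm (Fin d)}
    (hω : ∀ i : Fin d, (ω i : ℕ) = d - 1 - (i : ℕ)) (h : CountCoherent d ω τ) : τ = 1 := by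
  have hzero : ∀ a k : ℕ, k + a ≤ d → countLT d ω k a = 0 := by
    intro a k hk
    induction k with
    | zero => simp [countLT]
    | succ k ih =>
      rw [countLT_succ (by omega), ih (by omega), hω, if_neg (by simp only; omega)]
  refine perm_eq_of_forall_le fun i => Fin.le_def.2 ?_
  have hi := h (i + 1) i.2 (d - (i + 1)) (i + 1) (by omega)
  have hle := countLT_le i.2.le τ (i + 1)
  rw [hzero _ _ (by omega), countLT_succ i.2] at hi
  split_ifs at hi with hlt
  · simpa [Nat.lt_succ_iff] using hlt
  · omega

end Coh

open Coh in
/-- **Proposition.**  A pair `(σ,τ)` is coherent iff `(σ,τ)` and `(ω, id)` are related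
by a finite sequence of moves, where `ω` is the descending permutation. -/
theorem stmt_10 (d : ℕ) (hd : 1 ≤ d) (σ τ ω : Equiv.Perm (Fin d))
    (hω : ∀ i : Fin d, (ω i : ℕ) = d - 1 - (i : ℕ)) :
    Coherent d σ τ ↔ Relation.ReflTransGen (IsMove d) (σ, τ) (ω, 1) := by
  rw [coherent_iff_countCoherent]
  constructor
  · intro h
    obtain ⟨τ', hτ'⟩ := exists_reflTransGen_descending hω σ τ
    have : τ' = 1 := (CountCoherent.of_reflTransGen h hτ').eq_one hω
    exact this ▸ hτ'
  · intro h
    exact CountCoherent.of_reflTransGen (p := (ω, 1)) (q := (σ, τ))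
      (countCoherent_descending_one hω)
      (Relation.ReflTransGen.mono (fun _ _ hm => IsMove.symm hm) _ _ h.swap)
end
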